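/- Let d, r ≥ 1 and L ≥ 1 be integers, let Θ be a parameter space, and let f : Θ → (Fin r → ℝ) → ℝ be a parametric family of strictly positive functions. Suppose the class-conditional densities p_k : (Fin d → ℝ) → ℝ, for k ∈ Fin L, admit an f-expansion: p_k(z) = ∏_{t : Fin r → Fin d} f(θ_k(t))(z ∘ t), where θ_k(t) ∈ Θ are parameters. Let π : Fin L → ℝ be strictly positive class priors with ∑_k π_k = 1, and define the Bayes posterior P(k | z) = π_k · p_k(z) / ∑_{l} π_l · p_l(z). Then there exist functions ψ : ℝ → ℝ and φ : (Fin r → ℝ) × Θ × ℝ → ℝ, depending only on f, d, r, such that for every z and every k, P(k | z) = ψ(∑_{t : Fin r → Fin d} φ(z ∘ t, θ_k(t), π_k)) / ∑_{l} ψ(∑_{t : Fin r → Fin d} φ(z ∘ t, θ_l(t), π_l)). In fact one may take ψ(x) = exp(x) and φ(w, θ, π) = log f(θ)(w) + d^{-r} · log π. -/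

import Mathlib

/-- A positive weight times a finite product of positive factors is the exponential of a sum of
logarithms in which the weight is spread evenly over the index type. -/
theorem exp_sum_log_add_inv_card_mul_log {ι : Type*} [Fintype ι] [Nonempty ι]
    {g : ι → ℝ} (hg : ∀ i, 0 < g i) {c : ℝ} (hc : 0 < c) :
    Real.exp (∑ i, (Real.log (g i) + (Fintype.card ι : ℝ)⁻¹ * Real.log c)) = c * ∏ i, g i := by
  have hcard : (Fintype.card ι : ℝ) ≠ 0 := Nat.cast_ne_zero.mpr Fintype.card_ne_zero
  rw [Finset.sum_add_distrib, Finset.sum_const, Finset.card_univ, nsmul_eq_mul,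
    mul_inv_cancel_left₀ hcard, Real.exp_add, Real.exp_log hc, Real.exp_sum, mul_comm]
  simp only [Real.exp_log (hg _)]

/-- **Proposition 1 (DEN paper).** If the class-conditional densities admit an
`f`-expansion, then the Bayes posterior has the Deep-Sets (additive) form:
there exist `ψ` and `φ`, depending only on `f`, `d`, `r` (in fact one may take
`ψ = exp` and `φ (w, θ, π) = log (f θ w) + d⁻ʳ * log π`), such that
`P(k ∣ z) = ψ (∑ₜ φ (z ∘ t, θ k t, π k)) / ∑ₗ ψ (∑ₜ φ (z ∘ t, θ l t, π l))`. -/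
theorem den_prop1_bayes_classifier_deep_sets_form
    (d r L : ℕ) (hd : 1 ≤ d) (hr : 1 ≤ r) (hL : 1 ≤ L)
    {Θ : Type*} (f : Θ → (Fin r → ℝ) → ℝ)
    (hf : ∀ (θ : Θ) (w : Fin r → ℝ), 0 < f θ w)
    (θ : Fin L → (Fin r → Fin d) → Θ)
    (p : Fin L → (Fin d → ℝ) → ℝ)
    (hp : ∀ (k : Fin L) (z : Fin d → ℝ),
      p k z = ∏ t : Fin r → Fin d, f (θ k t) (z ∘ t))
    (pri : Fin L → ℝ) (hpri : ∀ k, 0 < pri k) (hsum : ∑ k, pri k = 1) :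
    ∃ (ψ : ℝ → ℝ) (φ : (Fin r → ℝ) × Θ × ℝ → ℝ),
      ψ = (fun x => Real.exp x) ∧
      φ = (fun w => Real.log (f w.2.1 w.1) + ((d : ℝ) ^ r)⁻¹ * Real.log w.2.2) ∧
      ∀ (z : Fin d → ℝ) (k : Fin L),
        pri k * p k z / (∑ l, pri l * p l z) =
          ψ (∑ t : Fin r → Fin d, φ (z ∘ t, θ k t, pri k)) /
            ∑ l, ψ (∑ t : Fin r → Fin d, φ (z ∘ t, θ l t, pri l)) := by
  refine ⟨_, _, rfl, rfl, fun z k => ?_⟩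
  have : Nonempty (Fin d) := ⟨⟨0, hd⟩⟩
  have key (l : Fin L) : Real.exp (∑ t : Fin r → Fin d,
      (Real.log (f (θ l t) (z ∘ t)) + ((d : ℝ) ^ r)⁻¹ * Real.log (pri l))) = pri l * p l z := by
    simpa [hp] using exp_sum_log_add_inv_card_mul_log
      (fun t : Fin r → Fin d => hf (θ l t) (z ∘ t)) (hpri l)
  simp only [key]
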